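/- Let I be a nonzero homogeneous ideal of a polynomial ring S over a field and f ∈ S a homogeneous polynomial of degree d > 0. Then reg(S/I) ≤ max{ reg(S/(I:f)) + d, reg(S/(I,f)) }, with the convention reg(S/S) = −∞. -/

import Mathlib

open MvPolynomial

noncomputable section

namespace EdgeIdealReg

open scoped Classical

/-- The edge ideal of a simple graph, in the polynomial ring with variables the vertices. -/
def edgeIdeal (K : Type) [Field K] {V : Type} (G : SimpleGraph V) :
    Ideal (MvPolynomial V K) :=
  Ideal.span { p | ∃ u v : V, G.Adj u v ∧ p = X u * X v }

/-- The edge ideal of the induced subgraph on a set `s` of vertices, viewed inside the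
polynomial ring of the ambient graph (extra variables do not change the regularity). -/
def edgeIdealOn (K : Type) [Field K] {V : Type} (G : SimpleGraph V) (s : Set V) :
    Ideal (MvPolynomial V K) :=
  Ideal.span { p | ∃ u v : V, G.Adj u v ∧ u ∈ s ∧ v ∈ s ∧ p = X u * X v }

/-- The `r`-th symbolic power of an ideal: the intersection over all minimal primes `p` of `I`
of the contraction of `I^r` localized at `p`; concretely,
`f ∈ I^{(r)}` iff for every minimal prime `p` of `I` there is `s ∉ p` with `s * f ∈ I ^ r`. -/
def symbolicPower {R : Type} [CommRing R] (I : Ideal R) (r : ℕ) : Ideal R where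
  carrier := { f | ∀ p ∈ I.minimalPrimes, ∃ s, s ∉ p ∧ s * f ∈ I ^ r }
  zero_mem' := by
    intro p hp
    exact ⟨1, (Ideal.ne_top_iff_one p).mp hp.1.1.ne_top, by simp⟩
  add_mem' := by
    intro a b ha hb p hp
    obtain ⟨s, hs, hsa⟩ := ha p hp
    obtain ⟨t, ht, htb⟩ := hb p hp
    refine ⟨s * t, fun h => ?_, ?_⟩
    · rcases hp.1.1.mem_or_mem h with h' | h'
      · exact hs h'
      · exact ht h'
    · have : s * t * (a + b) = t * (s * a) + s * (t * b) := by ring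
      rw [this]
      exact Ideal.add_mem _ (Ideal.mul_mem_left _ _ hsa) (Ideal.mul_mem_left _ _ htb)
  smul_mem' := by
    intro c f hf p hp
    obtain ⟨s, hs, hsf⟩ := hf p hp
    refine ⟨s, hs, ?_⟩
    have : s * (c • f) = c * (s * f) := by
      simp only [smul_eq_mul]; ring
    rw [this]
    exact Ideal.mul_mem_left _ _ hsf

/-- Symbolic power with an integer exponent, with the convention `I^{(k)} = S` for `k ≤ 0`. -/
def symbolicPowerZ {R : Type} [CommRing R] (I : Ideal R) (k : ℤ) : Ideal R :=
  if k ≤ 0 then ⊤ else symbolicPower I k.toNat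

/-- A graded free resolution of `S/I` over the polynomial ring `S = K[x_v]`:
`⋯ → F_{i+1} → F_i → ⋯ → F_0 = S → S/I → 0`, where `F_i` is a graded free module with
basis elements of degrees `deg i k`, the differentials are given by matrices of homogeneous
polynomials of the appropriate degrees, the image of `F_1 → F_0 = S` is `I`, and the
complex is exact in positive homological degrees. -/
structure GradedFreeResolution {K : Type} [Field K] {σ : Type}
    (I : Ideal (MvPolynomial σ K)) where
  rank : ℕ → ℕ
  deg : (i : ℕ) → Fin (rank i) → ℕ
  rank_zero : rank 0 = 1
  deg_zero : ∀ k, deg 0 k = 0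
  mat : (i : ℕ) → Matrix (Fin (rank i)) (Fin (rank (i + 1))) (MvPolynomial σ K)
  homog : ∀ i k j, mat i k j = 0 ∨
    ∃ e, deg (i + 1) j = deg i k + e ∧ (mat i k j).IsHomogeneous e
  range_zero : ∀ f : MvPolynomial σ K,
    f ∈ I ↔ (fun _ => f) ∈ LinearMap.range (Matrix.mulVecLin (mat 0))
  isExact : ∀ i, LinearMap.ker (Matrix.mulVecLin (mat i)) =
    LinearMap.range (Matrix.mulVecLin (mat (i + 1)))

/-- The Castelnuovo–Mumford regularity of the quotient `S/I` for a homogeneous ideal `I` of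
the polynomial ring: the least `d` such that some graded free resolution of `S/I` has all its
`i`-th syzygies generated in degrees `≤ d + i` (the minimal free resolution realizes the
infimum).  By convention `reg (S/S) = ⊥ = -∞`. -/

def regQuot {K : Type} [Field K] {σ : Type} (I : Ideal (MvPolynomial σ K)) : WithBot ℤ :=
  if I = ⊤ then ⊥
  else ((sInf { d : ℤ | ∃ F : GradedFreeResolution I,
      ∀ i (k : Fin (F.rank i)), (F.deg i k : ℤ) ≤ d + i } : ℤ) : WithBot ℤ)

/-- A set of edges of `G` that forms a matching: pairwise disjoint edges. -/
def IsMatchingSet {V : Type} (G : SimpleGraph V) (M : Finset (Sym2 V)) : Prop :=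
  (M : Set (Sym2 V)) ⊆ G.edgeSet ∧
    (M : Set (Sym2 V)).Pairwise fun e f => ∀ v, v ∈ e → v ∉ f

/-- An induced matching: a matching such that no two of its edges are joined by an edge
of `G`, i.e. it is the edge set of an induced subgraph. -/
def IsInducedMatchingSet {V : Type} (G : SimpleGraph V) (M : Finset (Sym2 V)) : Prop :=
  IsMatchingSet G M ∧
    (M : Set (Sym2 V)).Pairwise fun e f => ∀ u v, u ∈ e → v ∈ f → ¬G.Adj u v

/-- The matching number `mat(G)`. -/
def matchingNumber {V : Type} (G : SimpleGraph V) : ℕ :=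
  sSup { n | ∃ M, IsMatchingSet G M ∧ M.card = n }

/-- The induced matching number `ν(G)`. -/
def inducedMatchingNumber {V : Type} (G : SimpleGraph V) : ℕ :=
  sSup { n | ∃ M, IsInducedMatchingSet G M ∧ M.card = n }

/-- `G` has an induced cycle of length `n`. -/
def HasInducedCycle {V : Type} (G : SimpleGraph V) (n : ℕ) : Prop :=
  ∃ f : ZMod n → V, Function.Injective f ∧
    ∀ i j : ZMod n, G.Adj (f i) (f j) ↔ (j = i + 1 ∨ i = j + 1)

/-- A graph is chordal if every induced cycle has length `3`. -/
def Chordal {V : Type} (G : SimpleGraph V) : Prop :=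
  ∀ n, 4 ≤ n → ¬HasInducedCycle G n

/-- A graph is weakly chordal if every induced cycle in `G` and in `Gᶜ` has length at most 4. -/
def WeaklyChordal {V : Type} (G : SimpleGraph V) : Prop :=
  (∀ n, 5 ≤ n → ¬HasInducedCycle G n) ∧ ∀ n, 5 ≤ n → ¬HasInducedCycle Gᶜ n

/-- The co-chordal cover number `cochord(G)`: the least `n` such that `n` co-chordal
subgraphs of `G` cover all the edges of `G`. -/
def cochordNumber {V : Type} (G : SimpleGraph V) : ℕ :=
  sInf { n | ∃ H : Fin n → SimpleGraph V,
    (∀ i, H i ≤ G ∧ Chordal (H i)ᶜ) ∧ ∀ e ∈ G.edgeSet, ∃ i, e ∈ (H i).edgeSet }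

/-- A graph is unicyclic if it contains exactly one cycle. -/
def Unicyclic {V : Type} (G : SimpleGraph V) : Prop :=
  ∃ (v : V) (c : G.Walk v v), c.IsCycle ∧
    ∀ (w : V) (c' : G.Walk w w), c'.IsCycle → { e | e ∈ c'.edges } = { e | e ∈ c.edges }

/-- Data exhibiting `G` as the graph `H_T` obtained from the induced subgraph on `Hset`
by attaching, at each vertex of `T ⊆ Hset`, a union of complete graphs having that vertex as
their only common vertex: a family of cliques `C i` of `G`, each meeting `Hset` exactly in
its attachment vertex `a i ∈ T`, two distinct cliques meeting in at most the common
attachment vertex, together covering all vertices outside `Hset`, and all edges of `G`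
lying either inside `Hset` or inside one of the cliques. -/
structure CliqueAttachment {V : Type} (G : SimpleGraph V) (Hset T : Set V) where
  ι : Type
  C : ι → Finset V
  a : ι → V
  a_mem_T : ∀ i, a i ∈ T
  T_sub : T ⊆ Hset
  inter_H : ∀ i, (C i : Set V) ∩ Hset = {a i}
  a_mem_C : ∀ i, a i ∈ C i
  clique : ∀ i, G.IsClique (C i)
  pairwise_inter : ∀ i j, i ≠ j → (C i : Set V) ∩ (C j : Set V) ⊆ ({a i} : Set V)
  cover : Hset ∪ (⋃ i, (C i : Set V)) = Set.univ
  edges_sub : ∀ u v, G.Adj u v → (u ∈ Hset ∧ v ∈ Hset) ∨ ∃ i, u ∈ C i ∧ v ∈ C i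

end EdgeIdealReg

namespace RegAux

variable {σ K : Type} [Field K]

/-- Homogeneous component with an integer index (zero in negative degrees). -/
def hcz (n : ℤ) : MvPolynomial σ K →ₗ[K] MvPolynomial σ K :=
  if 0 ≤ n then homogeneousComponent n.toNat else 0

theorem coeff_hcz (n : ℤ) (p : MvPolynomial σ K) (m : σ →₀ ℕ) :
    coeff m (hcz n p) = if (m.degree : ℤ) = n then coeff m p else 0 := by
  classical
  unfold hcz
  split_ifs with h1 h2 h2
  · rw [coeff_homogeneousComponent, if_pos (by omega)]
  · rw [coeff_homogeneousComponent, if_neg (by omega)]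
  · omega
  · simp

theorem hcz_hcz (n m : ℤ) (p : MvPolynomial σ K) :
    hcz n (hcz m p) = if n = m then hcz n p else 0 := by
  ext u
  split_ifs with h
  · subst h; simp only [coeff_hcz]; split_ifs <;> rfl
  · simp only [coeff_hcz, coeff_zero]
    split_ifs <;> first | rfl | omega

theorem hcz_mul_of_left {c : ℤ} {q : MvPolynomial σ K} (hq : hcz c q = q) (n : ℤ)
    (p : MvPolynomial σ K) : hcz n (q * p) = q * hcz (n - c) p := by
  classical
  ext m
  rw [coeff_hcz, coeff_mul, coeff_mul]
  have key : ∀ x ∈ Finset.HasAntidiagonal.antidiagonal m, coeff x.1 q * coeff x.2 (hcz (n - c) p) =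
      if (m.degree : ℤ) = n then coeff x.1 q * coeff x.2 p else 0 := by
    intro x hx
    rw [Finset.HasAntidiagonal.mem_antidiagonal] at hx
    have hd : m.degree = x.1.degree + x.2.degree := by rw [← hx, map_add]
    have h1 : coeff x.1 q = if (x.1.degree : ℤ) = c then coeff x.1 q else 0 := by
      rw [← coeff_hcz, hq]
    by_cases hc : (x.1.degree : ℤ) = c
    · rw [coeff_hcz]
      have : ((x.2.degree : ℤ) = n - c) ↔ ((m.degree : ℤ) = n) := by omega
      simp only [this]
      split_ifs <;> simp
    · rw [if_neg hc] at h1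
      simp [h1]
  rw [Finset.sum_congr rfl key]
  split_ifs <;> simp

theorem hcz_eq_self_iff (n : ℕ) (p : MvPolynomial σ K) :
    hcz (n : ℤ) p = p ↔ p.IsHomogeneous n := by
  have : hcz (n : ℤ) p = homogeneousComponent n p := by simp [hcz]
  rw [this]
  constructor
  · intro h; rw [← h]; exact homogeneousComponent_isHomogeneous _ _
  · intro h; exact homogeneousComponent_eq_self h

theorem hcz_one_self : hcz (0 : ℤ) (1 : MvPolynomial σ K) = 1 :=
  (hcz_eq_self_iff 0 _).2 (isHomogeneous_one _ _)

/-- The degree `e` component of a vector in the free module with shifts `a`. -/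
def comp {ι : Type} (a : ι → ℕ) (e : ℕ) :
    (ι → MvPolynomial σ K) →ₗ[K] (ι → MvPolynomial σ K) :=
  LinearMap.pi fun i => (hcz ((e : ℤ) - a i)).comp (LinearMap.proj i)

theorem comp_apply {ι : Type} (a : ι → ℕ) (e : ℕ) (v : ι → MvPolynomial σ K) (i : ι) :
    comp a e v i = hcz ((e : ℤ) - a i) (v i) := rfl

theorem comp_comp {ι : Type} (a : ι → ℕ) (e e' : ℕ) (v : ι → MvPolynomial σ K) :
    comp a e (comp a e' v) = if e = e' then comp a e v else 0 := by
  ext1 i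
  rw [comp_apply, comp_apply, hcz_hcz]
  split_ifs with h1 h2 h2
  · rw [comp_apply]
  · omega
  · omega
  · rfl

theorem comp_self {ι : Type} (a : ι → ℕ) (e : ℕ) (v : ι → MvPolynomial σ K) :
    comp a e (comp a e v) = comp a e v := by
  rw [comp_comp, if_pos rfl]

theorem comp_eq_self_iff {ι : Type} (a : ι → ℕ) (e : ℕ) (v : ι → MvPolynomial σ K) :
    comp a e v = v ↔ ∀ i, v i = 0 ∨ ∃ c, e = a i + c ∧ (v i).IsHomogeneous c := by
  rw [funext_iff]
  refine forall_congr' fun i => ?_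
  rw [comp_apply]
  constructor
  · intro h
    by_cases hle : a i ≤ e
    · right
      refine ⟨e - a i, by omega, ?_⟩
      rw [← hcz_eq_self_iff, Nat.cast_sub hle, h]
    · left
      rw [← h, hcz, if_neg (by omega)]; rfl
  · rintro (h | ⟨c, hc, h⟩)
    · rw [h, map_zero]
    · rw [show (e : ℤ) - a i = (c : ℕ) by omega, hcz_eq_self_iff]; exact h

/-- Decomposition into homogeneous components. -/
theorem sum_comp_of_bound {ι : Type} (a : ι → ℕ) (D : ℕ) (v : ι → MvPolynomial σ K)
    (hD : ∀ i, a i + (v i).totalDegree < D) :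
    ∑ e ∈ Finset.range D, comp a e v = v := by
  classical
  ext1 i
  rw [Finset.sum_apply]
  ext m
  rw [coeff_sum]
  simp only [comp_apply, coeff_hcz]
  by_cases h0 : coeff m (v i) = 0
  · simp [h0]
  · have hm : m.degree ≤ (v i).totalDegree := by
      have := le_totalDegree (mem_support_iff.2 h0)
      exact this
    rw [Finset.sum_eq_single (m.degree + a i)]
    · rw [if_pos (by push_cast; ring)]
    · intro b _ hb
      rw [if_neg (by omega)]
    · intro h
      have := hD i
      rw [Finset.mem_range] at h
      omega

theorem exists_bound {ι : Type} [Fintype ι] (a : ι → ℕ) (v : ι → MvPolynomial σ K) :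
    ∃ D, ∀ i, a i + (v i).totalDegree < D := by
  refine ⟨(∑ i, (a i + (v i).totalDegree)) + 1, fun i => ?_⟩
  have := Finset.single_le_sum (f := fun i => a i + (v i).totalDegree)
    (fun _ _ => Nat.zero_le _) (Finset.mem_univ i)
  exact Nat.lt_succ_of_le this

/-- Homogeneous submodules. -/
def HomSub {ι : Type} (a : ι → ℕ) (N : Submodule (MvPolynomial σ K) (ι → MvPolynomial σ K)) :
    Prop := ∀ v ∈ N, ∀ e, comp a e v ∈ N

/-- Graded linear maps. -/
def GrL {ι κ : Type} (b : κ → ℕ) (a : ι → ℕ)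
    (φ : (κ → MvPolynomial σ K) →ₗ[MvPolynomial σ K] (ι → MvPolynomial σ K)) : Prop :=
  ∀ e v, comp a e (φ v) = φ (comp b e v)

/-- Linear combination of columns. -/
abbrev lc {ι κ : Type} [Fintype κ] (c : κ → ι → MvPolynomial σ K) :
    (κ → MvPolynomial σ K) →ₗ[MvPolynomial σ K] (ι → MvPolynomial σ K) :=
  Fintype.linearCombination (MvPolynomial σ K) c

theorem lc_apply {ι κ : Type} [Fintype κ] (c : κ → ι → MvPolynomial σ K)
    (v : κ → MvPolynomial σ K) : lc c v = ∑ j, v j • c j := rfl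

theorem lc_grL {ι κ : Type} [Fintype κ] {a : ι → ℕ} {b : κ → ℕ} {c : κ → ι → MvPolynomial σ K}
    (hc : ∀ j, comp a (b j) (c j) = c j) : GrL b a (lc c) := by
  intro e v
  rw [lc_apply, lc_apply, map_sum]
  refine Finset.sum_congr rfl fun j _ => ?_
  ext1 i
  rw [comp_apply, Pi.smul_apply, Pi.smul_apply, comp_apply, smul_eq_mul, smul_eq_mul, mul_comm]
  have h : hcz ((b j : ℤ) - a i) (c j i) = c j i := by rw [← comp_apply, hc]
  rw [hcz_mul_of_left h, mul_comm, show (e : ℤ) - a i - (b j - a i) = e - b j by ring]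

theorem lc_mem_col {ι κ : Type} [Fintype κ] (c : κ → ι → MvPolynomial σ K) (j : κ) :
    c j ∈ LinearMap.range (lc c) := by
  classical
  exact ⟨Pi.single j 1, by simp [lc]⟩

theorem GrL.ker {ι κ : Type} {b : κ → ℕ} {a : ι → ℕ}
    {φ : (κ → MvPolynomial σ K) →ₗ[MvPolynomial σ K] (ι → MvPolynomial σ K)}
    (h : GrL b a φ) : HomSub b (LinearMap.ker φ) := by
  intro v hv e
  rw [LinearMap.mem_ker] at hv ⊢
  rw [← h, hv, map_zero]

theorem GrL.lift {ι κ : Type} {b : κ → ℕ} {a : ι → ℕ}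
    {φ : (κ → MvPolynomial σ K) →ₗ[MvPolynomial σ K] (ι → MvPolynomial σ K)}
    (h : GrL b a φ) {N : Submodule (MvPolynomial σ K) (κ → MvPolynomial σ K)}
    (hN : HomSub b N) {e : ℕ} {w : ι → MvPolynomial σ K} (hw : comp a e w = w)
    (hwN : w ∈ N.map φ) : ∃ v ∈ N, comp b e v = v ∧ φ v = w := by
  obtain ⟨v, hv, rfl⟩ := hwN
  exact ⟨comp b e v, hN v hv e, comp_self _ _ _, by rw [← h, hw]⟩

/-- `P k a N r`: the graded submodule `N` has (up to stage `k`) a graded free resolution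
whose `i`-th generators have degree at most `r + i`. -/
def P : ℕ → {ι : Type} → (ι → ℕ) →
    Submodule (MvPolynomial σ K) (ι → MvPolynomial σ K) → ℕ → Prop
  | 0, _, _, _, _ => True
  | k + 1, ι, a, N, r => ∃ (κ : Type) (_ : Fintype κ) (b : κ → ℕ)
      (c : κ → ι → MvPolynomial σ K), (∀ j, b j ≤ r) ∧ (∀ j, comp a (b j) (c j) = c j) ∧
        LinearMap.range (lc c) = N ∧ P k b (LinearMap.ker (lc c)) (r + 1)

theorem P.mono {k : ℕ} : ∀ {ι : Type} {a : ι → ℕ}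
    {N : Submodule (MvPolynomial σ K) (ι → MvPolynomial σ K)} {r r' : ℕ},
    r ≤ r' → P k a N r → P k a N r' := by
  induction k with
  | zero => intros; trivial
  | succ k ih =>
    rintro ι a N r r' h ⟨κ, _, b, c, h1, h2, h3, h4⟩
    exact ⟨κ, ‹_›, b, c, fun j => (h1 j).trans h, h2, h3, ih (Nat.add_le_add_right h 1) h4⟩

theorem P.pred {k : ℕ} : ∀ {ι : Type} {a : ι → ℕ}
    {N : Submodule (MvPolynomial σ K) (ι → MvPolynomial σ K)} {r : ℕ},
    P (k + 1) a N r → P k a N r := by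
  induction k with
  | zero => intros; trivial
  | succ k ih =>
    rintro ι a N r ⟨κ, _, b, c, h1, h2, h3, h4⟩
    exact ⟨κ, ‹_›, b, c, h1, h2, h3, ih h4⟩

theorem P.shift {k : ℕ} (d : ℕ) : ∀ {ι : Type} {a : ι → ℕ}
    {N : Submodule (MvPolynomial σ K) (ι → MvPolynomial σ K)} {r : ℕ},
    P k a N r → P k (fun i => a i + d) N (r + d) := by
  induction k with
  | zero => intros; trivial
  | succ k ih =>
    rintro ι a N r ⟨κ, _, b, c, h1, h2, h3, h4⟩
    refine ⟨κ, ‹_›, fun j => b j + d, c, fun j => Nat.add_le_add_right (h1 j) d, fun j => ?_, h3, ?_⟩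
    · conv_rhs => rw [← h2 j]
      ext1 i
      rw [comp_apply, comp_apply]
      have : ((b j + d : ℕ) : ℤ) - (a i + d : ℕ) = (b j : ℤ) - a i := by push_cast; ring
      rw [this]
    · have := ih h4
      rwa [show r + 1 + d = r + d + 1 by ring] at this

/-- Invariance under graded maps injective on `N`. -/
theorem P.map {k : ℕ} {ι ι' : Type} {a : ι → ℕ} {a' : ι' → ℕ}
    {N : Submodule (MvPolynomial σ K) (ι → MvPolynomial σ K)} {r : ℕ}
    {φ : (ι → MvPolynomial σ K) →ₗ[MvPolynomial σ K] (ι' → MvPolynomial σ K)}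
    (hφ : GrL a a' φ) (hinj : ∀ v ∈ N, φ v = 0 → v = 0) (h : P k a N r) :
    P k a' (N.map φ) r := by
  cases k with
  | zero => trivial
  | succ k =>
    obtain ⟨κ, _, b, c, h1, h2, h3, h4⟩ := h
    have hcomp : lc (fun j => φ (c j)) = φ.comp (lc c) := by
      refine LinearMap.ext fun v => ?_
      simp [lc_apply, map_sum]
    refine ⟨κ, ‹_›, b, fun j => φ (c j), h1, fun j => by rw [hφ, h2], ?_, ?_⟩
    · rw [hcomp, LinearMap.range_comp, h3]
    · have : LinearMap.ker (lc fun j => φ (c j)) = LinearMap.ker (lc c) := by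
        rw [hcomp]
        ext v
        simp only [LinearMap.mem_ker, LinearMap.comp_apply]
        refine ⟨fun h => hinj _ ?_ h, fun h => by rw [h, map_zero]⟩
        rw [← h3]; exact ⟨v, rfl⟩
      rw [this]; exact h4

theorem P_bot {k : ℕ} {ι : Type} (a : ι → ℕ) (r : ℕ) :
    P k a (⊥ : Submodule (MvPolynomial σ K) (ι → MvPolynomial σ K)) r := by
  induction k generalizing ι r with
  | zero => trivial
  | succ k ih =>
    refine ⟨Empty, inferInstance, fun _ => 0, fun j => j.elim, fun j => j.elim,
      fun j => j.elim, ?_, ?_⟩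
    · rw [LinearMap.range_eq_bot]; refine LinearMap.ext fun v => ?_; simp [lc_apply]
    · have : LinearMap.ker (lc (fun j : Empty => (j.elim : ι → MvPolynomial σ K))) = ⊥ := by
        rw [Submodule.eq_bot_iff]
        intro v _; ext1 i; exact i.elim
      rw [this]; exact ih _ _

theorem comp_single {ι : Type} [DecidableEq ι] (a : ι → ℕ) (i : ι) :
    comp a (a i) (Pi.single i (1 : MvPolynomial σ K)) = Pi.single i 1 := by
  ext1 j
  rw [comp_apply]
  by_cases h : j = i
  · subst h; simp [hcz_one_self]
  · simp [h]

theorem P_top {k : ℕ} {ι : Type} [Fintype ι] (a : ι → ℕ) (r : ℕ) (h : ∀ i, a i ≤ r) :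
    P k a (⊤ : Submodule (MvPolynomial σ K) (ι → MvPolynomial σ K)) r := by
  classical
  cases k with
  | zero => trivial
  | succ k =>
    have hid : lc (fun i : ι => (Pi.single i 1 : ι → MvPolynomial σ K)) = LinearMap.id := by
      refine LinearMap.ext fun v => ?_
      ext1 i
      simp [lc_apply, Finset.sum_apply, Pi.single_apply]
    refine ⟨ι, inferInstance, a, fun i => Pi.single i 1, h, fun j => comp_single a j, ?_, ?_⟩
    · rw [hid, LinearMap.range_id]
    · rw [hid, LinearMap.ker_id]; exact P_bot _ _

/-- Projection to the second block. -/
def prR (κ₁ κ₂ : Type) : (κ₁ ⊕ κ₂ → MvPolynomial σ K) →ₗ[MvPolynomial σ K]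
    (κ₂ → MvPolynomial σ K) where
  toFun v := fun j => v (Sum.inr j)
  map_add' _ _ := rfl
  map_smul' _ _ := rfl

/-- Projection to the first block. -/
def prL (κ₁ κ₂ : Type) : (κ₁ ⊕ κ₂ → MvPolynomial σ K) →ₗ[MvPolynomial σ K]
    (κ₁ → MvPolynomial σ K) where
  toFun v := fun j => v (Sum.inl j)
  map_add' _ _ := rfl
  map_smul' _ _ := rfl

/-- Inclusion of the first block. -/
def inL (κ₁ κ₂ : Type) : (κ₁ → MvPolynomial σ K) →ₗ[MvPolynomial σ K]
    (κ₁ ⊕ κ₂ → MvPolynomial σ K) where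
  toFun v := Sum.elim v 0
  map_add' _ _ := by ext1 i; cases i <;> simp
  map_smul' _ _ := by ext1 i; cases i <;> simp

/-- Inclusion of the second block. -/
def inR (κ₁ κ₂ : Type) : (κ₂ → MvPolynomial σ K) →ₗ[MvPolynomial σ K]
    (κ₁ ⊕ κ₂ → MvPolynomial σ K) where
  toFun v := Sum.elim 0 v
  map_add' _ _ := by ext1 i; cases i <;> simp
  map_smul' _ _ := by ext1 i; cases i <;> simp

theorem prR_grL {κ₁ κ₂ : Type} (b₁ : κ₁ → ℕ) (b₂ : κ₂ → ℕ) :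
    GrL (Sum.elim b₁ b₂) b₂ (prR (σ := σ) (K := K) κ₁ κ₂) := fun _ _ => rfl

theorem prL_grL {κ₁ κ₂ : Type} (b₁ : κ₁ → ℕ) (b₂ : κ₂ → ℕ) :
    GrL (Sum.elim b₁ b₂) b₁ (prL (σ := σ) (K := K) κ₁ κ₂) := fun _ _ => rfl

theorem inL_grL {κ₁ κ₂ : Type} (b₁ : κ₁ → ℕ) (b₂ : κ₂ → ℕ) :
    GrL b₁ (Sum.elim b₁ b₂) (inL (σ := σ) (K := K) κ₁ κ₂) := by
  intro e v
  ext1 i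
  cases i <;> simp [comp_apply, inL]

theorem inR_grL {κ₁ κ₂ : Type} (b₁ : κ₁ → ℕ) (b₂ : κ₂ → ℕ) :
    GrL b₂ (Sum.elim b₁ b₂) (inR (σ := σ) (K := K) κ₁ κ₂) := by
  intro e v
  ext1 i
  cases i <;> simp [comp_apply, inR]

theorem lc_sum {ι κ₁ κ₂ : Type} [Fintype κ₁] [Fintype κ₂] (c₁ : κ₁ → ι → MvPolynomial σ K)
    (c₂ : κ₂ → ι → MvPolynomial σ K) (v : κ₁ ⊕ κ₂ → MvPolynomial σ K) :
    lc (Sum.elim c₁ c₂) v = lc c₁ (prL _ _ v) + lc c₂ (prR _ _ v) := by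
  simp [lc_apply, prL, prR, Fintype.sum_sum_type]

theorem lc_mem {ι κ : Type} [Fintype κ] {c : κ → ι → MvPolynomial σ K}
    {N : Submodule (MvPolynomial σ K) (ι → MvPolynomial σ K)} (h : ∀ j, c j ∈ N)
    (v : κ → MvPolynomial σ K) : lc c v ∈ N :=
  Submodule.sum_mem _ fun j _ => Submodule.smul_mem _ _ (h j)

/-- Extension (horseshoe) lemma. -/
theorem P.ext {k : ℕ} : ∀ {ι ι' : Type} {a : ι → ℕ} {a' : ι' → ℕ}
    {B : Submodule (MvPolynomial σ K) (ι → MvPolynomial σ K)}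
    {π : (ι → MvPolynomial σ K) →ₗ[MvPolynomial σ K] (ι' → MvPolynomial σ K)} {r : ℕ},
    GrL a a' π → HomSub a B → P k a (B ⊓ LinearMap.ker π) r → P k a' (B.map π) r →
    P k a B r := by
  induction k with
  | zero => intros; trivial
  | succ k ih =>
    rintro ι ι' a a' B π r hπ hB ⟨κ₁, _, b₁, c₁, h11, h12, h13, h14⟩
      ⟨κ₂, _, b₂, c₂, h21, h22, h23, h24⟩
    have hl : ∀ j, ∃ v ∈ B, comp a (b₂ j) v = v ∧ π v = c₂ j := fun j =>
      hπ.lift hB (h22 j) (h23 ▸ lc_mem_col c₂ j)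
    choose c₂' hc1 hc2 hc3 using hl
    have hπc : ∀ w, π (lc c₂' w) = lc c₂ w := by
      intro w; simp [lc_apply, hc3]
    have hc1mem : ∀ w, lc c₁ w ∈ B ⊓ LinearMap.ker π := by
      intro w; rw [← h13]; exact ⟨w, rfl⟩
    have hgr : ∀ j, comp a (Sum.elim b₁ b₂ j) (Sum.elim c₁ c₂' j) = Sum.elim c₁ c₂' j := by
      intro j; cases j
      · exact h12 _
      · exact hc2 _
    refine ⟨κ₁ ⊕ κ₂, inferInstance, Sum.elim b₁ b₂, Sum.elim c₁ c₂', ?_, hgr, ?_, ?_⟩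
    · intro j; cases j
      · exact h11 _
      · exact h21 _
    · apply le_antisymm
      · rintro _ ⟨v, rfl⟩
        rw [lc_sum]
        exact B.add_mem (hc1mem _).1 (lc_mem hc1 _)
      · intro v hv
        have : π v ∈ LinearMap.range (lc c₂) := by rw [h23]; exact ⟨v, hv, rfl⟩
        obtain ⟨y, hy⟩ := this
        have h2 : v - lc c₂' y ∈ LinearMap.range (lc c₁) := by
          rw [h13]
          refine ⟨B.sub_mem hv (lc_mem hc1 _), ?_⟩
          rw [SetLike.mem_coe, LinearMap.mem_ker, map_sub, hπc, hy, sub_self]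
        obtain ⟨x, hx⟩ := h2
        refine ⟨Sum.elim x y, ?_⟩
        rw [lc_sum]
        change lc c₁ x + lc c₂' y = v
        rw [hx]; abel
    · refine ih (prR_grL b₁ b₂) (lc_grL hgr).ker ?_ ?_
      · have : LinearMap.ker (lc (Sum.elim c₁ c₂')) ⊓ LinearMap.ker (prR κ₁ κ₂) =
            (LinearMap.ker (lc c₁)).map (inL κ₁ κ₂) := by
          ext v
          constructor
          · rintro ⟨h1, h2⟩
            rw [SetLike.mem_coe, LinearMap.mem_ker] at h1 h2
            rw [lc_sum, h2, map_zero, add_zero] at h1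
            refine ⟨prL _ _ v, h1, ?_⟩
            ext1 i
            cases i with
            | inl i => rfl
            | inr i => exact (congrFun h2 i).symm
          · rintro ⟨x, hx, rfl⟩
            refine ⟨?_, rfl⟩
            rw [SetLike.mem_coe, LinearMap.mem_ker] at hx ⊢
            rw [lc_sum]
            change lc c₁ x + lc c₂' 0 = 0
            rw [hx, map_zero, add_zero]
        rw [this]
        refine P.map (inL_grL b₁ b₂) ?_ h14
        intro v _ hv
        ext1 i
        exact congrFun hv (Sum.inl i)
      · have : (LinearMap.ker (lc (Sum.elim c₁ c₂'))).map (prR κ₁ κ₂) =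
            LinearMap.ker (lc c₂) := by
          ext y
          constructor
          · rintro ⟨v, hv, rfl⟩
            rw [SetLike.mem_coe, LinearMap.mem_ker, lc_sum] at hv
            rw [LinearMap.mem_ker, ← hπc]
            have h0 := (hc1mem (prL _ _ v)).2
            rw [SetLike.mem_coe, LinearMap.mem_ker] at h0
            have := congrArg π hv
            rwa [map_add, h0, zero_add, map_zero] at this
          · intro hy
            rw [LinearMap.mem_ker] at hy
            have h2 : lc c₂' y ∈ LinearMap.range (lc c₁) := by
              rw [h13]
              refine ⟨lc_mem hc1 _, ?_⟩
              rw [SetLike.mem_coe, LinearMap.mem_ker, hπc, hy]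
            obtain ⟨x, hx⟩ := h2
            refine ⟨Sum.elim (-x) y, ?_, rfl⟩
            rw [SetLike.mem_coe, LinearMap.mem_ker, lc_sum]
            change lc c₁ (-x) + lc c₂' y = 0
            rw [map_neg, hx, neg_add_cancel]
        rw [this]; exact h24

/-- Retract lemma. -/
theorem P.retract {k : ℕ} : ∀ {ι ι' : Type} {a : ι → ℕ} {a' : ι' → ℕ}
    {N : Submodule (MvPolynomial σ K) (ι → MvPolynomial σ K)}
    {N' : Submodule (MvPolynomial σ K) (ι' → MvPolynomial σ K)}
    {φ : (ι → MvPolynomial σ K) →ₗ[MvPolynomial σ K] (ι' → MvPolynomial σ K)}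
    {ψ : (ι' → MvPolynomial σ K) →ₗ[MvPolynomial σ K] (ι → MvPolynomial σ K)} {r : ℕ},
    GrL a a' φ → GrL a' a ψ → (∀ v ∈ N, φ v ∈ N') → (∀ v ∈ N', ψ v ∈ N) →
    (∀ v ∈ N', φ (ψ v) = v) → P k a N r → P k a' N' r := by
  induction k with
  | zero => intros; trivial
  | succ k ih =>
    intro ι ι' a a' N N' φ ψ r hφ hψ h1 h2 h3 hP
    have hQ : P k a (N ⊓ LinearMap.ker φ) r := by
      refine ih (φ := LinearMap.id - ψ.comp φ) (ψ := LinearMap.id) ?_ (fun _ _ => rfl) ?_ ?_ ?_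
        hP.pred
      · intro e v
        simp only [LinearMap.sub_apply, LinearMap.id_apply, LinearMap.comp_apply, map_sub]
        rw [hψ, hφ]
      · intro v hv
        refine ⟨N.sub_mem hv (h2 _ (h1 _ hv)), ?_⟩
        simp only [SetLike.mem_coe, LinearMap.mem_ker, LinearMap.sub_apply, LinearMap.id_apply,
          LinearMap.comp_apply, map_sub]
        rw [h3 _ (h1 _ hv), sub_self]
      · intro v hv; exact hv.1
      · rintro v ⟨_, hv⟩
        rw [SetLike.mem_coe, LinearMap.mem_ker] at hv
        simp [hv]
    obtain ⟨κ, _, b, c, g1, g2, g3, g4⟩ := hP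
    have hcomp : lc (fun j => φ (c j)) = φ.comp (lc c) := by
      refine LinearMap.ext fun v => ?_
      simp [lc_apply, map_sum]
    have hgr : ∀ j, comp a' (b j) (φ (c j)) = φ (c j) := fun j => by rw [hφ, g2]
    have hcN : ∀ w, lc c w ∈ N := fun w => by rw [← g3]; exact ⟨w, rfl⟩
    refine ⟨κ, inferInstance, b, fun j => φ (c j), g1, hgr, ?_, ?_⟩
    · rw [hcomp, LinearMap.range_comp, g3]
      apply le_antisymm
      · rintro _ ⟨v, hv, rfl⟩; exact h1 v hv
      · intro v hv; exact ⟨ψ v, h2 v hv, h3 v hv⟩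
    · refine P.ext (lc_grL g2) (lc_grL hgr).ker ?_ ?_
      · have : LinearMap.ker (lc fun j => φ (c j)) ⊓ LinearMap.ker (lc c) =
            LinearMap.ker (lc c) := by
          rw [hcomp, inf_eq_right]
          exact LinearMap.ker_le_ker_comp _ _
        rw [this]; exact g4
      · have : (LinearMap.ker (lc fun j => φ (c j))).map (lc c) = N ⊓ LinearMap.ker φ := by
          rw [hcomp]
          ext v
          constructor
          · rintro ⟨w, hw, rfl⟩
            exact ⟨hcN w, hw⟩
          · rintro ⟨hv, hv'⟩
            rw [← g3] at hv
            obtain ⟨w, rfl⟩ := hv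
            exact ⟨w, hv', rfl⟩
        rw [this]; exact hQ.mono (Nat.le_succ _)

theorem HomSub.top {ι : Type} (a : ι → ℕ) :
    HomSub a (⊤ : Submodule (MvPolynomial σ K) (ι → MvPolynomial σ K)) := fun _ _ _ => trivial

/-- Independence of the choice of cover. -/
theorem P.ker_of_cover {k : ℕ} {ι κ : Type} [Fintype κ] {a : ι → ℕ}
    {N : Submodule (MvPolynomial σ K) (ι → MvPolynomial σ K)} {r : ℕ} (hP : P (k + 1) a N r)
    {b : κ → ℕ} {c : κ → ι → MvPolynomial σ K} (h1 : ∀ j, b j ≤ r)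
    (h2 : ∀ j, comp a (b j) (c j) = c j) (h3 : LinearMap.range (lc c) = N) :
    P k b (LinearMap.ker (lc c)) (r + 1) := by
  obtain ⟨κ', _, b', c', g1, g2, g3, g4⟩ := hP
  -- lifts of the second family of columns through the first
  have hl : ∀ j, ∃ t ∈ (⊤ : Submodule (MvPolynomial σ K) (κ → MvPolynomial σ K)),
      comp b (b' j) t = t ∧ lc c t = c' j := fun j =>
    (lc_grL h2).lift (HomSub.top b) (g2 j) (by
      rw [Submodule.map_top, h3, ← g3]; exact lc_mem_col c' j)
  choose t _ ht1 ht2 using hl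
  have hlt : ∀ w, lc c (lc t w) = lc c' w := by
    intro w
    rw [lc_apply t, map_sum]
    simp only [map_smul, ht2]
    rfl
  have hneg : ∀ j, comp a (b j) (-c j) = -c j := fun j => by rw [map_neg, h2]
  have hgr : ∀ j, comp a (Sum.elim b' b j) (Sum.elim c' (fun j => -c j) j) =
      Sum.elim c' (fun j => -c j) j := by
    intro j; cases j
    · exact g2 _
    · exact hneg _
  have hlcneg : ∀ w, lc (fun j => -c j) w = - lc c w := by
    intro w; simp [lc_apply]
  set X := LinearMap.ker (lc (Sum.elim c' (fun j => -c j))) with hX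
  have memX : ∀ v, v ∈ X ↔ lc c' (prL _ _ v) = lc c (prR _ _ v) := by
    intro v
    rw [hX, LinearMap.mem_ker, lc_sum, hlcneg, ← sub_eq_add_neg, sub_eq_zero]
  have hPX : P k (Sum.elim b' b) X (r + 1) := by
    refine P.ext (prR_grL b' b) (lc_grL hgr).ker ?_ ?_
    · have : X ⊓ LinearMap.ker (prR κ' κ) = (LinearMap.ker (lc c')).map (inL κ' κ) := by
        ext v
        constructor
        · rintro ⟨h1, h2⟩
          rw [SetLike.mem_coe] at h1 h2
          rw [LinearMap.mem_ker] at h2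
          rw [memX, h2, map_zero] at h1
          refine ⟨prL _ _ v, h1, ?_⟩
          ext1 i
          cases i with
          | inl i => rfl
          | inr i => exact (congrFun h2 i).symm
        · rintro ⟨x, hx, rfl⟩
          refine ⟨?_, rfl⟩
          rw [SetLike.mem_coe] at hx ⊢
          rw [LinearMap.mem_ker] at hx
          rw [memX]
          change lc c' x = lc c 0
          rw [hx, map_zero]
      rw [this]
      refine P.map (inL_grL b' b) ?_ g4
      intro v _ hv
      ext1 i
      exact congrFun hv (Sum.inl i)
    · have : X.map (prR κ' κ) = ⊤ := by
        rw [eq_top_iff]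
        intro y _
        have hy : lc c y ∈ LinearMap.range (lc c') := by
          rw [g3, ← h3]; exact ⟨y, rfl⟩
        obtain ⟨x, hx⟩ := hy
        exact ⟨Sum.elim x y, (memX _).2 hx, rfl⟩
      rw [this]
      exact P_top _ _ fun j => (h1 j).trans (Nat.le_succ _)
  refine P.retract (φ := prR κ' κ - (lc t).comp (prL κ' κ)) (ψ := inR κ' κ) ?_ (inR_grL b' b)
    ?_ ?_ ?_ hPX
  · intro e v
    simp only [LinearMap.sub_apply, LinearMap.comp_apply, map_sub]
    rw [prR_grL b' b, lc_grL ht1, prL_grL b' b]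
  · intro v hv
    rw [memX] at hv
    simp only [LinearMap.mem_ker, LinearMap.sub_apply, LinearMap.comp_apply, map_sub]
    rw [hlt, hv, sub_self]
  · intro v hv
    rw [LinearMap.mem_ker] at hv
    rw [memX]
    change lc c' 0 = lc c v
    rw [hv, map_zero]
  · intro v _
    simp only [LinearMap.sub_apply, LinearMap.comp_apply]
    change v - lc t 0 = v
    rw [map_zero, sub_zero]

/-- A finitely generated homogeneous submodule has a graded cover. -/
theorem exists_cover {ι : Type} (a : ι → ℕ)
    {N : Submodule (MvPolynomial σ K) (ι → MvPolynomial σ K)} (hN : HomSub a N)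
    (s : Finset (ι → MvPolynomial σ K)) (hs : Submodule.span _ (s : Set _) = N)
    (D : ℕ) (hD : ∀ v ∈ s, ∀ i, a i + (v i).totalDegree < D) :
    ∃ (κ : Type) (_ : Fintype κ) (b : κ → ℕ) (c : κ → ι → MvPolynomial σ K),
      (∀ j, b j < D) ∧ (∀ j, comp a (b j) (c j) = c j) ∧ LinearMap.range (lc c) = N := by
  refine ⟨s × Fin D, inferInstance, fun j => j.2, fun j => comp a j.2 j.1, fun j => j.2.2,
    fun j => comp_self _ _ _, ?_⟩
  apply le_antisymm
  · rintro _ ⟨v, rfl⟩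
    refine lc_mem (fun j => hN _ ?_ _) v
    rw [← hs]; exact Submodule.subset_span j.1.2
  · rw [← hs, Submodule.span_le]
    intro v hv
    rw [SetLike.mem_coe, ← sum_comp_of_bound a D v (hD v hv)]
    refine Submodule.sum_mem _ fun e he => ?_
    exact lc_mem_col (fun j : s × Fin D => comp a j.2 (j.1 : ι → MvPolynomial σ K))
      (⟨v, hv⟩, ⟨e, Finset.mem_range.1 he⟩)

theorem exists_cover_fg {ι : Type} [Fintype ι] (a : ι → ℕ)
    {N : Submodule (MvPolynomial σ K) (ι → MvPolynomial σ K)} (hN : HomSub a N)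
    (hfg : N.FG) :
    ∃ (D : ℕ) (κ : Type) (_ : Fintype κ) (b : κ → ℕ) (c : κ → ι → MvPolynomial σ K),
      (∀ j, b j < D) ∧ (∀ j, comp a (b j) (c j) = c j) ∧ LinearMap.range (lc c) = N := by
  obtain ⟨s, hs⟩ := hfg
  choose D hD using fun v : ι → MvPolynomial σ K => exists_bound a v
  refine ⟨∑ v ∈ s, D v, exists_cover a hN s hs _ fun v hv i => (hD v i).trans_le ?_⟩
  exact Finset.single_le_sum (f := D) (fun _ _ => Nat.zero_le _) hv

/-- Setting the variable `x_0` to zero. -/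
def rho (n : ℕ) : MvPolynomial (Fin (n + 1)) K →+* MvPolynomial (Fin n) K :=
  Polynomial.constantCoeff.comp (finSuccEquiv K n : _ →+* _)

theorem rho_apply (n : ℕ) (p : MvPolynomial (Fin (n + 1)) K) :
    rho n p = (finSuccEquiv K n p).coeff 0 := rfl

theorem coeff_rho (n : ℕ) (p : MvPolynomial (Fin (n + 1)) K) (m : Fin n →₀ ℕ) :
    coeff m (rho n p) = coeff (m.cons 0) p := by
  rw [rho_apply, finSuccEquiv_coeff_coeff]

theorem rho_hcz (n : ℕ) (e : ℤ) (p : MvPolynomial (Fin (n + 1)) K) :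
    rho n (hcz e p) = hcz e (rho n p) := by
  ext m
  rw [coeff_rho, coeff_hcz, coeff_hcz, coeff_rho]
  have : (Finsupp.cons 0 m).degree = m.degree := by
    rw [Finsupp.degree_eq_sum, Finsupp.degree_eq_sum, Fin.sum_univ_succ]
    simp
  rw [this]

theorem rho_surjective (n : ℕ) : Function.Surjective (rho (K := K) n) := by
  intro p
  refine ⟨(finSuccEquiv K n).symm (Polynomial.C p), ?_⟩
  rw [rho_apply]; simp

theorem rho_eq_zero (n : ℕ) (p : MvPolynomial (Fin (n + 1)) K) (h : rho n p = 0) :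
    ∃ q, p = X 0 * q := by
  rw [rho_apply, ← Polynomial.X_dvd_iff] at h
  obtain ⟨q, hq⟩ := h
  refine ⟨(finSuccEquiv K n).symm q, (finSuccEquiv K n).injective ?_⟩
  rw [map_mul, finSuccEquiv_X_zero, hq]; simp

theorem rho_X0 (n : ℕ) : rho (K := K) n (X 0) = 0 := by
  rw [rho_apply, finSuccEquiv_X_zero]; simp

/-- Coordinatewise reduction. -/
def red {n : ℕ} {ι : Type} (v : ι → MvPolynomial (Fin (n + 1)) K) : ι → MvPolynomial (Fin n) K :=
  fun i => rho n (v i)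

theorem red_comp {n : ℕ} {ι : Type} (a : ι → ℕ) (e : ℕ)
    (v : ι → MvPolynomial (Fin (n + 1)) K) : red (comp a e v) = comp a e (red v) := by
  ext1 i
  exact rho_hcz n _ _

theorem red_lc {n : ℕ} {ι κ : Type} [Fintype κ] (c : κ → ι → MvPolynomial (Fin (n + 1)) K)
    (v : κ → MvPolynomial (Fin (n + 1)) K) :
    red (lc c v) = lc (fun j => red (c j)) (red v) := by
  ext1 i
  simp [red, lc_apply, Finset.sum_apply, map_sum]

theorem red_surj {n : ℕ} {ι : Type} (w : ι → MvPolynomial (Fin n) K) :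
    ∃ v : ι → MvPolynomial (Fin (n + 1)) K, red v = w := by
  choose g hg using rho_surjective (K := K) n
  exact ⟨fun i => g (w i), funext fun i => hg _⟩

theorem red_sub {n : ℕ} {ι : Type} (v w : ι → MvPolynomial (Fin (n + 1)) K) :
    red (v - w) = red v - red w := by
  ext1 i; simp [red]

theorem red_eq_zero {n : ℕ} {ι : Type} (v : ι → MvPolynomial (Fin (n + 1)) K)
    (h : red v = 0) : ∃ q : ι → MvPolynomial (Fin (n + 1)) K,
      v = (X 0 : MvPolynomial (Fin (n + 1)) K) • q := by
  choose q hq using fun i => rho_eq_zero n (v i) (congrFun h i)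
  exact ⟨q, funext hq⟩

theorem comp_X_smul {n : ℕ} {ι : Type} (a : ι → ℕ) (e : ℕ)
    (q : ι → MvPolynomial (Fin (n + 1)) K) :
    comp a (e + 1) ((X 0 : MvPolynomial (Fin (n + 1)) K) • q) =
      (X 0 : MvPolynomial (Fin (n + 1)) K) • comp a e q := by
  ext1 i
  have hX : hcz (1 : ℤ) (X 0 : MvPolynomial (Fin (n + 1)) K) = X 0 :=
    (hcz_eq_self_iff 1 _).2 (isHomogeneous_X _ _)
  rw [comp_apply, Pi.smul_apply, Pi.smul_apply, comp_apply, smul_eq_mul, smul_eq_mul,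
    hcz_mul_of_left hX]
  congr 2
  push_cast; ring_nf

theorem comp_zero_X_smul {n : ℕ} {ι : Type} (a : ι → ℕ)
    (q : ι → MvPolynomial (Fin (n + 1)) K) :
    comp a 0 ((X 0 : MvPolynomial (Fin (n + 1)) K) • q) = 0 := by
  ext1 i
  have hX : hcz (1 : ℤ) (X 0 : MvPolynomial (Fin (n + 1)) K) = X 0 :=
    (hcz_eq_self_iff 1 _).2 (isHomogeneous_X _ _)
  rw [comp_apply, Pi.smul_apply, smul_eq_mul, hcz_mul_of_left hX, hcz, if_neg (by push_cast; omega)]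
  simp

/-- Lifting resolutions from `S/x` to `S`. -/
theorem P.of_red {n k : ℕ} : ∀ {ι : Type} [Fintype ι] {a : ι → ℕ}
    {Z : Submodule (MvPolynomial (Fin (n + 1)) K) (ι → MvPolynomial (Fin (n + 1)) K)}
    {Zb : Submodule (MvPolynomial (Fin n) K) (ι → MvPolynomial (Fin n) K)} {r : ℕ},
    HomSub a Z → (∀ v, (X 0 : MvPolynomial (Fin (n + 1)) K) • v ∈ Z → v ∈ Z) →
    (∀ w, w ∈ Zb ↔ ∃ z ∈ Z, red z = w) → P k a Zb r → P k a Z r := by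
  induction k with
  | zero => intros; trivial
  | succ k ih =>
    rintro ι _ a Z Zb r hZ hsat hred ⟨κ, _, b, cb, h1, h2, h3, h4⟩
    have hl : ∀ j, ∃ z ∈ Z, comp a (b j) z = z ∧ red z = cb j := by
      intro j
      have : cb j ∈ Zb := by rw [← h3]; exact lc_mem_col cb j
      obtain ⟨z, hz, hz'⟩ := (hred _).1 this
      exact ⟨comp a (b j) z, hZ z hz _, comp_self _ _ _, by rw [red_comp, hz', h2]⟩
    choose c hc1 hc2 hc3 using hl
    have hrlc : ∀ v, red (lc c v) = lc cb (red v) := by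
      intro v; rw [red_lc]; simp only [hc3]
    have hgrb := lc_grL h2
    have hgr := lc_grL hc2
    -- graded Nakayama
    have nak : ∀ e, ∀ z ∈ Z, comp a e z = z → z ∈ LinearMap.range (lc c) := by
      intro e
      induction e with
      | zero =>
        intro z hz hez
        have hzb : red z ∈ LinearMap.range (lc cb) := by
          rw [h3]; exact (hred _).2 ⟨z, hz, rfl⟩
        obtain ⟨sb, hsb⟩ := hzb
        obtain ⟨s, rfl⟩ := red_surj sb
        rw [← hrlc] at hsb
        have hy : red (z - lc c (comp b 0 s)) = 0 := by
          rw [← hgr, red_sub, red_comp, hsb, ← red_comp, hez, sub_self]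
        obtain ⟨q, hq⟩ := red_eq_zero _ hy
        have hy2 : comp a 0 (z - lc c (comp b 0 s)) = z - lc c (comp b 0 s) := by
          rw [map_sub, hez, hgr, comp_self]
        rw [hq, comp_zero_X_smul, ← hq, eq_comm, sub_eq_zero] at hy2
        exact ⟨_, hy2.symm⟩
      | succ e ihe =>
        intro z hz hez
        have hzb : red z ∈ LinearMap.range (lc cb) := by
          rw [h3]; exact (hred _).2 ⟨z, hz, rfl⟩
        obtain ⟨sb, hsb⟩ := hzb
        obtain ⟨s, rfl⟩ := red_surj sb
        rw [← hrlc] at hsb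
        have hy : red (z - lc c (comp b (e + 1) s)) = 0 := by
          rw [← hgr, red_sub, red_comp, hsb, ← red_comp, hez, sub_self]
        obtain ⟨q, hq⟩ := red_eq_zero _ hy
        have hy2 : comp a (e + 1) (z - lc c (comp b (e + 1) s)) =
            z - lc c (comp b (e + 1) s) := by
          rw [map_sub, hez, hgr, comp_self]
        have hqZ : q ∈ Z := by
          apply hsat
          rw [← hq]
          exact Z.sub_mem hz (lc_mem hc1 _)
        rw [hq, comp_X_smul, ← hq] at hy2
        have hq' := ihe _ (hZ q hqZ e) (comp_self _ _ _)
        have : z = (X 0 : MvPolynomial (Fin (n + 1)) K) • comp a e q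
            + lc c (comp b (e + 1) s) := by rw [hy2]; abel
        rw [this]
        exact Submodule.add_mem _ (Submodule.smul_mem _ _ hq') ⟨_, rfl⟩
    have hrange : LinearMap.range (lc c) = Z := by
      apply le_antisymm
      · rintro _ ⟨v, rfl⟩; exact lc_mem hc1 v
      · intro z hz
        obtain ⟨D, hD⟩ := exists_bound a z
        rw [← sum_comp_of_bound a D z hD]
        exact Submodule.sum_mem _ fun e _ => nak e _ (hZ z hz e) (comp_self _ _ _)
    refine ⟨κ, inferInstance, b, c, h1, hc2, hrange, ?_⟩
    refine ih (Zb := LinearMap.ker (lc cb)) hgr.ker ?_ ?_ h4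
    · intro v hv
      rw [LinearMap.mem_ker, map_smul, smul_eq_zero] at hv
      exact hv.resolve_left (X_ne_zero _)
    · intro w
      constructor
      · intro hw
        rw [LinearMap.mem_ker] at hw
        obtain ⟨h, rfl⟩ := red_surj w
        rw [← hrlc] at hw
        obtain ⟨q, hq⟩ := red_eq_zero _ hw
        have hqZ : q ∈ LinearMap.range (lc c) := by
          rw [hrange]; apply hsat; rw [← hq]; exact lc_mem hc1 _
        obtain ⟨h', rfl⟩ := hqZ
        refine ⟨h - (X 0 : MvPolynomial (Fin (n + 1)) K) • h', ?_, ?_⟩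
        · rw [LinearMap.mem_ker, map_sub, map_smul, hq, sub_self]
        · rw [red_sub]
          ext1 i
          simp [red, rho_X0]
      · rintro ⟨z, hz, rfl⟩
        rw [LinearMap.mem_ker] at hz ⊢
        rw [← hrlc, hz]
        ext1 i; simp [red]

theorem P_fin_zero {k : ℕ} : ∀ {ι : Type} [Fintype ι] {a : ι → ℕ}
    {N : Submodule (MvPolynomial (Fin 0) K) (ι → MvPolynomial (Fin 0) K)} {r : ℕ},
    HomSub a N → (∀ i, a i ≤ r) → P k a N r := by
  induction k with
  | zero => intros; trivial
  | succ k ih =>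
    intro ι _ a N r hN ha
    obtain ⟨s, hs⟩ : N.FG := IsNoetherian.noetherian N
    obtain ⟨κ, _, b, c, h1, h2, h3⟩ := exists_cover a hN s hs (r + 1) (fun v _ i => by
      rw [(totalDegree_zero_iff_isHomogeneous _).2 (isHomogeneous_of_isEmpty _ _ _)]
      exact Nat.lt_succ_of_le (ha i))
    exact ⟨κ, inferInstance, b, c, fun j => Nat.le_of_lt_succ (h1 j), h2, h3,
      (ih (lc_grL h2).ker fun j => Nat.le_of_lt_succ (h1 j)).mono (Nat.le_succ r)⟩

/-- Every homogeneous submodule of a finite free module over a polynomial ring in finitely many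
variables has finite regularity. -/
theorem exists_P_fin (n : ℕ) : ∀ {ι : Type} [Fintype ι] {a : ι → ℕ}
    {N : Submodule (MvPolynomial (Fin n) K) (ι → MvPolynomial (Fin n) K)},
    HomSub a N → ∃ r, ∀ k, P k a N r := by
  induction n with
  | zero =>
    intro ι _ a N hN
    refine ⟨∑ i, a i, fun k => P_fin_zero hN fun i => ?_⟩
    exact Finset.single_le_sum (f := a) (fun _ _ => Nat.zero_le _) (Finset.mem_univ i)
  | succ n ih =>
    intro ι _ a N hN
    obtain ⟨D, κ, _, b, c, h1, h2, h3⟩ :=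
      exists_cover_fg a hN (IsNoetherian.noetherian N)
    let Zb : Submodule (MvPolynomial (Fin n) K) (κ → MvPolynomial (Fin n) K) :=
      { carrier := {w | ∃ z ∈ LinearMap.ker (lc c), red z = w}
        zero_mem' := ⟨0, Submodule.zero_mem _, by ext1 i; simp [red]⟩
        add_mem' := by
          rintro _ _ ⟨z, hz, rfl⟩ ⟨z', hz', rfl⟩
          exact ⟨z + z', Submodule.add_mem _ hz hz', by ext1 i; simp [red]⟩
        smul_mem' := by
          rintro p _ ⟨z, hz, rfl⟩
          obtain ⟨q, rfl⟩ := rho_surjective n p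
          exact ⟨q • z, Submodule.smul_mem _ _ hz, by ext1 i; simp [red]⟩ }
    have hgr := lc_grL h2
    have hZb : HomSub b Zb := by
      rintro _ ⟨z, hz, rfl⟩ e
      exact ⟨comp b e z, hgr.ker z hz e, red_comp _ _ _⟩
    obtain ⟨r, hr⟩ := ih hZb
    refine ⟨r + D, fun k => ?_⟩
    cases k with
    | zero => trivial
    | succ k =>
      refine ⟨κ, inferInstance, b, c, fun j => by have := h1 j; omega, h2, h3, ?_⟩
      refine (P.of_red (Zb := Zb) hgr.ker ?_ (fun w => Iff.rfl) (hr k)).mono (by omega)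
      intro v hv
      rw [LinearMap.mem_ker, map_smul, smul_eq_zero] at hv
      exact hv.resolve_left (X_ne_zero _)


/-- Coefficientwise extraction. -/
def coefv {n : ℕ} {ρ ι : Type}
    (Φ : MvPolynomial σ K ≃+* MvPolynomial ρ (MvPolynomial (Fin n) K)) (m : ρ →₀ ℕ)
    (w : ι → MvPolynomial σ K) : ι → MvPolynomial (Fin n) K :=
  fun i => coeff m (Φ (w i))

theorem coeff_mul_C_right {ρ R : Type} [CommRing R] (m : ρ →₀ ℕ) (p : MvPolynomial ρ R) (r : R) :
    coeff m (p * C r) = coeff m p * r := by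
  rw [mul_comm, coeff_C_mul, mul_comm]

theorem coefv_lc {n : ℕ} {ρ ι κ : Type} [Fintype κ]
    {Φ : MvPolynomial σ K ≃+* MvPolynomial ρ (MvPolynomial (Fin n) K)}
    {j : MvPolynomial (Fin n) K →+* MvPolynomial σ K} (hΦ : ∀ p, Φ (j p) = C p)
    (m : ρ →₀ ℕ) (c : κ → ι → MvPolynomial (Fin n) K) (v : κ → MvPolynomial σ K) :
    coefv Φ m (lc (fun q i => j (c q i)) v) = lc c (coefv Φ m v) := by
  ext1 i
  simp only [coefv, lc_apply, Finset.sum_apply, Pi.smul_apply, smul_eq_mul, map_sum, map_mul, hΦ,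
    coeff_sum, coeff_mul_C_right]

theorem P.base_change {n k : ℕ} {ρ : Type}
    {Φ : MvPolynomial σ K ≃+* MvPolynomial ρ (MvPolynomial (Fin n) K)}
    {j : MvPolynomial (Fin n) K →+* MvPolynomial σ K} (hΦ : ∀ p, Φ (j p) = C p)
    (hj : ∀ e p, j (hcz e p) = hcz e (j p)) : ∀ {ι : Type} [Fintype ι] {a : ι → ℕ}
    {N : Submodule (MvPolynomial (Fin n) K) (ι → MvPolynomial (Fin n) K)}
    {Ne : Submodule (MvPolynomial σ K) (ι → MvPolynomial σ K)} {r : ℕ},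
    (∀ w, w ∈ Ne ↔ ∀ m, coefv Φ m w ∈ N) → P k a N r → P k a Ne r := by
  classical
  induction k with
  | zero => intros; trivial
  | succ k ih =>
    rintro ι _ a N Ne r hNe ⟨κ, _, b, c, h1, h2, h3, h4⟩
    refine ⟨κ, inferInstance, b, fun q i => j (c q i), h1, fun q => ?_, ?_, ?_⟩
    · ext1 i
      rw [comp_apply, ← hj, ← comp_apply, h2]
    · apply le_antisymm
      · rintro _ ⟨v, rfl⟩
        rw [hNe]
        intro m
        rw [coefv_lc hΦ, ← h3]
        exact ⟨_, rfl⟩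
      · intro w hw
        rw [hNe] at hw
        let T : Finset (ρ →₀ ℕ) := Finset.univ.biUnion fun i => (Φ (w i)).support
        have hT : w = ∑ m ∈ T, Φ.symm (monomial m 1) • fun i => j (coefv Φ m w i) := by
          ext1 i
          apply Φ.injective
          rw [Finset.sum_apply, map_sum]
          simp only [Pi.smul_apply, smul_eq_mul, map_mul, hΦ, RingEquiv.apply_symm_apply]
          ext1 m
          rw [coeff_sum]
          simp only [coeff_mul_C_right, coeff_monomial, coefv, ite_mul, one_mul, zero_mul]
          rw [Finset.sum_ite_eq' T m]
          split_ifs with h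
          · rfl
          · by_contra h0
            exact h (Finset.mem_biUnion.2 ⟨i, Finset.mem_univ _, mem_support_iff.2 h0⟩)
        rw [hT]
        refine Submodule.sum_mem _ fun m _ => Submodule.smul_mem _ _ ?_
        have := hw m
        rw [← h3] at this
        obtain ⟨u, hu⟩ := this
        refine ⟨fun q => j (u q), ?_⟩
        rw [← hu]
        ext1 i
        simp [lc_apply, Finset.sum_apply]
    · refine ih (fun w => ?_) h4
      simp only [LinearMap.mem_ker, ← coefv_lc hΦ]
      constructor
      · intro h m; rw [h]; ext1 i; simp [coefv]
      · intro h
        ext1 i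
        apply Φ.injective
        rw [Pi.zero_apply, map_zero]
        ext1 m
        exact congrFun (h m) i

/-- Splitting the variables of a polynomial ring. -/
theorem exists_split {n : ℕ} (g : Fin n → σ) (hg : Function.Injective g) :
    ∃ (ρ : Type) (Φ : MvPolynomial σ K ≃+* MvPolynomial ρ (MvPolynomial (Fin n) K)),
      ∀ p, Φ (rename g p) = C p := by
  classical
  let ρ : Type := {x // x ∉ Set.range g}
  let e : σ ≃ ρ ⊕ Fin n := ((Equiv.sumComm _ _).trans
    ((Equiv.sumCongr (Equiv.ofInjective g hg) (Equiv.refl _)).trans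
      (Equiv.sumCompl (fun x => x ∈ Set.range g)))).symm
  have he : ∀ i, e (g i) = Sum.inr i := by
    intro i
    rw [Equiv.symm_apply_eq]
    rfl
  let Φ := (renameEquiv K e).trans (sumAlgEquiv K ρ (Fin n))
  refine ⟨ρ, Φ.toRingEquiv, fun p => ?_⟩
  have : (Φ : MvPolynomial σ K →ₐ[K] _).comp (rename g) =
      (IsScalarTower.toAlgHom K (MvPolynomial (Fin n) K) (MvPolynomial ρ (MvPolynomial (Fin n) K)))
      := by
    ext1 i
    simp [Φ, he, IsScalarTower.toAlgHom_apply, algebraMap_eq]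
  exact DFunLike.congr_fun this p

theorem rename_hcz {n : ℕ} (g : Fin n → σ) (e : ℤ)
    (p : MvPolynomial (Fin n) K) : rename g (hcz e p) = hcz e (rename g p) := by
  unfold hcz
  split_ifs
  · rw [rename_homogeneousComponent]
  · simp


/-- An ideal as a submodule of the free module of rank one. -/
def Jsub (J : Ideal (MvPolynomial σ K)) :
    Submodule (MvPolynomial σ K) (Fin 1 → MvPolynomial σ K) :=
  Submodule.comap (LinearMap.proj 0) J

theorem mem_Jsub {J : Ideal (MvPolynomial σ K)} {v : Fin 1 → MvPolynomial σ K} :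
    v ∈ Jsub J ↔ v 0 ∈ J := Iff.rfl

/-- Homogeneous ideals. -/
def HomI (J : Ideal (MvPolynomial σ K)) : Prop := ∀ p ∈ J, ∀ n : ℤ, hcz n p ∈ J

theorem HomI.homSub {J : Ideal (MvPolynomial σ K)} (h : HomI J) :
    HomSub (fun _ => 0) (Jsub J) := fun v hv e => h (v 0) hv ((e : ℤ) - (0 : ℕ))

theorem HomI_span (s : Set (MvPolynomial σ K)) (hs : ∀ p ∈ s, ∃ n, p.IsHomogeneous n) :
    HomI (Ideal.span s) := by
  intro p hp n
  induction hp using Submodule.span_induction generalizing n with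
  | mem x hx =>
    obtain ⟨c, hc⟩ := hs x hx
    have := hcz_mul_of_left ((hcz_eq_self_iff c x).2 hc) n 1
    rw [mul_one] at this
    rw [this]
    exact Ideal.mul_mem_right _ _ (Ideal.subset_span hx)
  | zero => rw [map_zero]; exact Ideal.zero_mem _
  | add x y _ _ hx hy => rw [map_add]; exact Ideal.add_mem _ (hx n) (hy n)
  | smul a x _ hx =>
    -- decompose `x` into homogeneous components
    have hD := sum_comp_of_bound (ι := Fin 1) (fun _ => 0) (x.totalDegree + 1) (fun _ => x)
      (fun _ => by omega)
    have hx' : x = ∑ e ∈ Finset.range (x.totalDegree + 1), hcz (e : ℤ) x := by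
      have := congrFun hD 0
      rw [Finset.sum_apply] at this
      simpa [comp_apply] using this.symm
    rw [smul_eq_mul, mul_comm]
    have : hcz n (x * a) = ∑ e ∈ Finset.range (x.totalDegree + 1),
        hcz (e : ℤ) x * hcz (n - e) a := by
      conv_lhs => rw [hx', Finset.sum_mul, map_sum]
      refine Finset.sum_congr rfl fun e _ => ?_
      rw [hcz_mul_of_left]
      rw [hcz_hcz, if_pos rfl]
    rw [this]
    exact Ideal.sum_mem _ fun e _ => Ideal.mul_mem_right _ _ (hx _)

theorem mem_colon_span {R : Type} [CommRing R] (I : Ideal R) (f p : R) :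
    p ∈ Submodule.colon I (Ideal.span {f} : Set R) ↔ f * p ∈ I := by
  rw [Submodule.mem_colon]
  constructor
  · intro h
    have := h f (Ideal.mem_span_singleton_self f)
    rwa [smul_eq_mul, mul_comm] at this
  · intro h s hs
    obtain ⟨t, rfl⟩ := Ideal.mem_span_singleton'.1 hs
    have := I.mul_mem_left t h
    rw [smul_eq_mul]
    rwa [show p * (t * f) = t * (f * p) by ring]

theorem HomI.colon {I : Ideal (MvPolynomial σ K)} (h : HomI I) {f : MvPolynomial σ K} {d : ℕ}
    (hf : f.IsHomogeneous d) :
    HomI (Submodule.colon I (Ideal.span {f} : Set (MvPolynomial σ K))) := by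
  intro p hp n
  rw [mem_colon_span] at hp ⊢
  have := h _ hp (n + d)
  rwa [hcz_mul_of_left ((hcz_eq_self_iff d f).2 hf), add_sub_cancel_right] at this

theorem mem_sup_span {R : Type} [CommRing R] (I : Ideal R) (f p : R) :
    p ∈ I ⊔ Ideal.span {f} ↔ ∃ i ∈ I, ∃ q, p = i + f * q := by
  rw [Submodule.mem_sup]
  constructor
  · rintro ⟨i, hi, y, hy, rfl⟩
    obtain ⟨t, rfl⟩ := Ideal.mem_span_singleton'.1 hy
    exact ⟨i, hi, t, by ring⟩
  · rintro ⟨i, hi, q, rfl⟩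
    exact ⟨i, hi, f * q, Ideal.mul_mem_right _ _ (Ideal.mem_span_singleton_self f), rfl⟩

theorem HomI.sup {I : Ideal (MvPolynomial σ K)} (h : HomI I) {f : MvPolynomial σ K} {d : ℕ}
    (hf : f.IsHomogeneous d) : HomI (I ⊔ Ideal.span {f}) := by
  intro p hp n
  rw [mem_sup_span] at hp ⊢
  obtain ⟨i, hi, q, rfl⟩ := hp
  refine ⟨hcz n i, h i hi n, hcz (n - d) q, ?_⟩
  rw [map_add, hcz_mul_of_left ((hcz_eq_self_iff d f).2 hf)]

theorem exists_P_of_coeff {n : ℕ} {ρ : Type} {g : Fin n → σ}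
    {Φ : MvPolynomial σ K ≃+* MvPolynomial ρ (MvPolynomial (Fin n) K)}
    (hΦ : ∀ p, Φ (rename g p) = C p)
    {J : Ideal (MvPolynomial σ K)} {J0 : Ideal (MvPolynomial (Fin n) K)} (h0 : HomI J0)
    (h : ∀ p, p ∈ J ↔ ∀ m, coeff m (Φ p) ∈ J0) :
    ∃ r, ∀ k, P k (fun _ => 0) (Jsub J) r := by
  obtain ⟨r, hr⟩ := exists_P_fin n h0.homSub
  refine ⟨r, fun k => P.base_change (j := (rename g : MvPolynomial (Fin n) K →ₐ[K] _).toRingHom)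
    hΦ (fun e p => rename_hcz g e p) (fun w => ?_) (hr k)⟩
  exact h (w 0)

theorem mem_map_rename {n : ℕ} {ρ : Type} {g : Fin n → σ}
    {Φ : MvPolynomial σ K ≃+* MvPolynomial ρ (MvPolynomial (Fin n) K)}
    (hΦ : ∀ p, Φ (rename g p) = C p) (J0 : Ideal (MvPolynomial (Fin n) K))
    (p : MvPolynomial σ K) :
    p ∈ J0.map (rename g : MvPolynomial (Fin n) K →ₐ[K] MvPolynomial σ K) ↔
      ∀ m, coeff m (Φ p) ∈ J0 := by
  rw [← mem_map_C_iff]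
  have : J0.map (C : _ →+* MvPolynomial ρ (MvPolynomial (Fin n) K)) =
      (J0.map (rename g : MvPolynomial (Fin n) K →ₐ[K] MvPolynomial σ K)).map Φ := by
    apply le_antisymm
    · rw [Ideal.map_le_iff_le_comap]
      intro q hq
      rw [Ideal.mem_comap, ← hΦ]
      exact Ideal.mem_map_of_mem _ (Ideal.mem_map_of_mem _ hq)
    · rw [Ideal.map_le_iff_le_comap, Ideal.map_le_iff_le_comap]
      intro q hq
      rw [Ideal.mem_comap, Ideal.mem_comap, hΦ]
      exact Ideal.mem_map_of_mem _ hq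
  rw [this]
  constructor
  · intro h; exact Ideal.mem_map_of_mem _ h
  · intro h
    obtain ⟨q, hq, hqp⟩ := (Ideal.mem_map_of_equiv Φ _).1 h
    rwa [Φ.injective hqp] at hq

theorem exists_P_colon_sup {I : Ideal (MvPolynomial σ K)} (hI : HomI I) (hfg : I.FG)
    {f : MvPolynomial σ K} {d : ℕ} (hf : f.IsHomogeneous d) :
    (∃ r, ∀ k, P k (fun _ => 0)
      (Jsub (Submodule.colon I (Ideal.span {f} : Set (MvPolynomial σ K)))) r) ∧
    (∃ r, ∀ k, P k (fun _ => 0) (Jsub (I ⊔ Ideal.span {f})) r) := by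
  classical
  obtain ⟨s, hs⟩ := hfg
  let τ : Finset σ := f.vars ∪ s.biUnion vars
  let g : Fin τ.card → σ := fun i => (τ.equivFin.symm i).1
  have hg : Function.Injective g := Subtype.val_injective.comp τ.equivFin.symm.injective
  have hgr : ∀ x ∈ τ, x ∈ Set.range g := fun x hx => ⟨τ.equivFin ⟨x, hx⟩, by simp [g]⟩
  obtain ⟨ρ, Φ, hΦ⟩ := exists_split (K := K) g hg
  obtain ⟨f0, hf0⟩ := exists_rename_eq_of_vars_subset_range f g hg (fun x hx =>
    hgr x (Finset.mem_union_left _ hx))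
  have hf0h : f0.IsHomogeneous d := by
    rw [← IsHomogeneous.rename_isHomogeneous_iff hg, hf0]; exact hf
  let I0 : Ideal (MvPolynomial (Fin τ.card) K) :=
    I.comap (rename g : MvPolynomial (Fin τ.card) K →ₐ[K] MvPolynomial σ K)
  have hI0 : HomI I0 := by
    intro p hp n
    rw [Ideal.mem_comap] at hp ⊢
    rw [rename_hcz]; exact hI _ hp n
  have hImap : I = I0.map (rename g : MvPolynomial (Fin τ.card) K →ₐ[K] MvPolynomial σ K) := by
    apply le_antisymm
    · conv_lhs => rw [← hs]
      rw [Submodule.span_le]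
      intro p hp
      obtain ⟨p0, rfl⟩ := exists_rename_eq_of_vars_subset_range p g hg (fun x hx =>
        hgr x (Finset.mem_union_right _ (Finset.mem_biUnion.2 ⟨p, hp, hx⟩)))
      refine Ideal.mem_map_of_mem _ ?_
      rw [Ideal.mem_comap, ← hs]
      exact Submodule.subset_span hp
    · exact Ideal.map_comap_le
  have hmem : ∀ p, p ∈ I ↔ ∀ m, coeff m (Φ p) ∈ I0 := by
    intro p
    conv_lhs => rw [hImap]
    exact mem_map_rename hΦ I0 p
  constructor
  · refine exists_P_of_coeff hΦ (hI0.colon hf0h) fun p => ?_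
    rw [mem_colon_span, hmem]
    refine forall_congr' fun m => ?_
    rw [mem_colon_span, map_mul, ← hf0, hΦ, coeff_C_mul]
  · refine exists_P_of_coeff hΦ (hI0.sup hf0h) fun p => ?_
    rw [← mem_map_rename hΦ, Ideal.map_sup, ← hImap, Ideal.map_span, Set.image_singleton, hf0]


open EdgeIdealReg

theorem lc_eq_mulVecLin {m n : ℕ} (M : Matrix (Fin m) (Fin n) (MvPolynomial σ K)) :
    lc (fun j k => M k j) = Matrix.mulVecLin M := by
  refine LinearMap.ext fun v => ?_
  ext1 i
  simp [lc_apply, Finset.sum_apply, Matrix.mulVec, dotProduct, mul_comm]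

theorem P_of_res {I : Ideal (MvPolynomial σ K)} (F : GradedFreeResolution I) (D : ℕ)
    (hF : ∀ i k, F.deg i k ≤ D + i) (k : ℕ) : ∀ i,
    P k (F.deg i) (LinearMap.range (Matrix.mulVecLin (F.mat i))) (D + i + 1) := by
  induction k with
  | zero => intros; trivial
  | succ k ih =>
    intro i
    refine ⟨Fin (F.rank (i + 1)), inferInstance, F.deg (i + 1), fun j k => F.mat i k j,
      fun j => hF _ _, fun j => ?_, ?_, ?_⟩
    · rw [comp_eq_self_iff]
      exact fun k => F.homog i k j
    · rw [lc_eq_mulVecLin]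
    · rw [lc_eq_mulVecLin, F.isExact]
      exact ih (i + 1)

theorem P_Jsub_of_res {I : Ideal (MvPolynomial σ K)} (F : GradedFreeResolution I) (D : ℕ)
    (hF : ∀ i k, F.deg i k ≤ D + i) (k : ℕ) :
    P k (fun _ => 0) (Jsub I) (D + 1) := by
  have h := P_of_res F D hF k 0
  let k0 : Fin (F.rank 0) := ⟨0, by rw [F.rank_zero]; exact Nat.one_pos⟩
  have hk0 : ∀ i : Fin (F.rank 0), i = k0 := by
    intro i
    have := i.2
    have h0 := F.rank_zero
    ext; simp only [k0]; omega
  let φ : (Fin (F.rank 0) → MvPolynomial σ K) →ₗ[MvPolynomial σ K] (Fin 1 → MvPolynomial σ K) :=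
    LinearMap.pi fun _ => LinearMap.proj k0
  have hφ : GrL (F.deg 0) (fun _ => 0) φ := by
    intro e v
    ext1 i
    simp [φ, comp_apply, F.deg_zero]
  have := P.map hφ (fun v _ hv => by
    ext1 i
    rw [hk0 i]
    exact congrFun hv 0) h
  convert this using 1
  ext v
  rw [mem_Jsub, F.range_zero]
  constructor
  · intro hv
    refine ⟨_, hv, ?_⟩
    ext1 i
    rw [Subsingleton.elim i 0]; rfl
  · rintro ⟨w, hw, rfl⟩
    have hww : (fun _ => φ w 0) = w := by
      ext1 i
      rw [hk0 i]; rfl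
    rw [hww]; exact hw

theorem FG_of_res {I : Ideal (MvPolynomial σ K)} (F : GradedFreeResolution I) (D : ℕ)
    (hF : ∀ i k, F.deg i k ≤ D + i) : I.FG := by
  classical
  obtain ⟨κ, _, b, c, _, _, h3, _⟩ := P_Jsub_of_res F D hF 1
  have : I = Submodule.map (LinearMap.proj 0) (Jsub I) := by
    ext p
    constructor
    · intro hp; exact ⟨fun _ => p, hp, rfl⟩
    · rintro ⟨v, hv, rfl⟩; exact hv
  rw [this, ← h3]
  refine Submodule.FG.map _ ?_
  rw [← Submodule.map_top]
  exact Submodule.FG.map _ Module.Finite.fg_top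

/-- A stage in the construction of a resolution. -/
structure Stage (σ K : Type) [Field K] where
  n : ℕ
  a : Fin n → ℕ
  N : Submodule (MvPolynomial σ K) (Fin n → MvPolynomial σ K)
  r : ℕ
  h : ∀ k, P k a N r

theorem Stage.exists_next (s : Stage σ K) : ∃ (t : Stage σ K)
    (c : Fin t.n → Fin s.n → MvPolynomial σ K),
    t.r = s.r + 1 ∧ (∀ j, t.a j ≤ s.r) ∧ (∀ j, comp s.a (t.a j) (c j) = c j) ∧
      LinearMap.range (lc c) = s.N ∧ t.N = LinearMap.ker (lc c) := by
  obtain ⟨κ, _, b, c, h1, h2, h3, _⟩ := s.h 1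
  let e := Fintype.equivFin κ
  have hr : LinearMap.range (lc fun j => c (e.symm j)) = s.N := by
    rw [← h3]
    apply le_antisymm
    · rintro _ ⟨v, rfl⟩
      exact lc_mem (fun j => lc_mem_col c _) v
    · rintro _ ⟨v, rfl⟩
      refine lc_mem (fun j => ?_) v
      have := lc_mem_col (fun j => c (e.symm j)) (e j)
      simpa using this
  exact ⟨⟨Fintype.card κ, fun j => b (e.symm j), LinearMap.ker (lc fun j => c (e.symm j)), s.r + 1,
    fun k => P.ker_of_cover (s.h (k + 1)) (fun j => h1 _) (fun j => h2 _) hr⟩,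
    fun j => c (e.symm j), rfl, fun j => h1 _, fun j => h2 _, hr, rfl⟩

theorem res_of_P {I : Ideal (MvPolynomial σ K)} (D : ℕ)
    (h : ∀ k, P k (fun _ => 0) (Jsub I) (D + 1)) :
    ∃ F : GradedFreeResolution I, ∀ i k, F.deg i k ≤ D + i := by
  choose nx c hr ha hc hrange hN using fun s : Stage σ K => s.exists_next
  let s0 : Stage σ K := ⟨1, fun _ => 0, Jsub I, D + 1, h⟩
  let sq : ℕ → Stage σ K := fun i => Nat.rec s0 (fun _ s => nx s) i
  have hsr : ∀ i, (sq i).r = D + 1 + i := by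
    intro i
    induction i with
    | zero => rfl
    | succ i ih =>
      have : (sq (i + 1)).r = (sq i).r + 1 := hr (sq i)
      rw [this, ih]; ring
  have hM : ∀ i, Matrix.mulVecLin (Matrix.of fun k j => c (sq i) j k) = lc (c (sq i)) := by
    intro i
    rw [← lc_eq_mulVecLin]; rfl
  refine ⟨{ rank := fun i => (sq i).n
            deg := fun i => (sq i).a
            rank_zero := rfl
            deg_zero := fun _ => rfl
            mat := fun i => Matrix.of fun k j => c (sq i) j k
            homog := fun i k j => (comp_eq_self_iff _ _ _).1 (hc (sq i) j) k
            range_zero := ?_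
            isExact := ?_ }, ?_⟩
  · intro f
    have e0 := (congrArg LinearMap.range (hM 0)).trans (hrange (sq 0))
    exact (show f ∈ I ↔ (fun _ => f) ∈ (sq 0).N from Iff.rfl).trans
      (Iff.of_eq (congrArg (fun N => (fun _ => f) ∈ N) e0.symm))
  · intro i
    exact (congrArg LinearMap.ker (hM i)).trans ((hN (sq i)).symm.trans
      ((congrArg LinearMap.range (hM (i + 1))).trans (hrange (sq (i + 1)))).symm)
  · intro i k
    cases i with
    | zero => exact Nat.zero_le _
    | succ i =>
      have := ha (sq i) k
      rw [hsr] at this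
      change (nx (sq i)).a k ≤ _
      omega

/-- The exact sequence argument. -/
theorem P_main {I : Ideal (MvPolynomial σ K)} (hI : HomI I) {f : MvPolynomial σ K} {d : ℕ}
    (hf : f.IsHomogeneous d) {k r : ℕ} {r1 : ℕ} (hr : r1 + d ≤ r)
    (h1 : P k (fun _ => 0) (Jsub (Submodule.colon I (Ideal.span {f} : Set (MvPolynomial σ K)))) r1)
    (h2 : P k (fun _ => 0) (Jsub (I ⊔ Ideal.span {f})) r) :
    P k (fun _ => 0) (Jsub I) r := by
  have hfz : hcz (d : ℤ) f = f := (hcz_eq_self_iff d f).2 hf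
  let a : Fin 1 ⊕ Fin 1 → ℕ := Sum.elim (fun _ => 0) (fun _ => d)
  let B : Submodule (MvPolynomial σ K) (Fin 1 ⊕ Fin 1 → MvPolynomial σ K) :=
    (Jsub I).comap (prL _ _)
  let π : (Fin 1 ⊕ Fin 1 → MvPolynomial σ K) →ₗ[MvPolynomial σ K] (Fin 1 → MvPolynomial σ K) :=
    prL _ _ + f • prR _ _
  have hπ : GrL a (fun _ => 0) π := by
    intro e v
    ext1 i
    simp only [π, comp_apply, LinearMap.add_apply, LinearMap.smul_apply, Pi.add_apply,
      Pi.smul_apply, smul_eq_mul, map_add, hcz_mul_of_left hfz, prL, prR, LinearMap.coe_mk,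
      AddHom.coe_mk, a, Sum.elim_inl, Sum.elim_inr]
    simp
  let ψ : (Fin 1 → MvPolynomial σ K) →ₗ[MvPolynomial σ K] (Fin 1 ⊕ Fin 1 → MvPolynomial σ K) :=
    f • inL _ _ - inR _ _
  have hψ : GrL (fun _ => 0 + d) a ψ := by
    intro e v
    ext1 i
    rcases i with i | i <;>
    simp [ψ, comp_apply, inL, inR, a, hcz_mul_of_left hfz]
  have hB : HomSub a B := fun v hv e => hI.homSub _ hv e
  have hker : P k a (B ⊓ LinearMap.ker π) r := by
    have := P.map hψ (fun v _ hv => by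
      ext1 i
      have := congrFun hv (Sum.inr i)
      simpa [ψ, inL, inR] using this) (h1.shift d)
    refine P.mono hr ?_
    convert this using 1
    ext v
    simp only [Submodule.mem_inf, LinearMap.mem_ker, Submodule.mem_map]
    constructor
    · rintro ⟨hv, hv0⟩
      have h0 : v (Sum.inl 0) + f * v (Sum.inr 0) = 0 := congrFun hv0 0
      refine ⟨fun i => - v (Sum.inr i), ?_, ?_⟩
      · rw [mem_Jsub, mem_colon_span]
        have : v (Sum.inl 0) ∈ I := hv
        rw [eq_neg_of_add_eq_zero_left h0] at this
        simpa using this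
      · ext1 i
        rcases i with i | i
        · rw [Subsingleton.elim i 0]
          simp [ψ, inL, inR, eq_neg_of_add_eq_zero_left h0]
        · simp [ψ, inL, inR]
    · rintro ⟨w, hw, rfl⟩
      rw [mem_Jsub, mem_colon_span] at hw
      constructor
      · change ψ w (Sum.inl 0) ∈ I
        simpa [ψ, inL, inR] using hw
      · ext1 i
        simp [π, ψ, prL, prR, inL, inR]
  have himg : B.map π = Jsub (I ⊔ Ideal.span {f}) := by
    ext v
    rw [mem_Jsub, mem_sup_span]
    constructor
    · rintro ⟨w, hw, rfl⟩
      exact ⟨w (Sum.inl 0), hw, w (Sum.inr 0), rfl⟩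
    · rintro ⟨i, hi, q, hq⟩
      refine ⟨Sum.elim (fun _ => i) (fun _ => q), hi, ?_⟩
      ext1 j
      rw [Subsingleton.elim j 0, hq]; rfl
  have hPB : P k a B r := P.ext hπ hB hker (himg ▸ h2)
  exact P.retract (prL_grL _ _) (inL_grL _ _) (fun v hv => hv) (fun v hv => hv)
    (fun v _ => rfl) hPB

/-- The set of integers whose infimum is the regularity. -/
def regSet (I : Ideal (MvPolynomial σ K)) : Set ℤ :=
  { d : ℤ | ∃ F : GradedFreeResolution I, ∀ i (k : Fin (F.rank i)), (F.deg i k : ℤ) ≤ d + i }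

theorem regSet_nonneg {I : Ideal (MvPolynomial σ K)} {d : ℤ} (h : d ∈ regSet I) : 0 ≤ d := by
  obtain ⟨F, hF⟩ := h
  have := hF 0 ⟨0, by rw [F.rank_zero]; exact Nat.one_pos⟩
  rw [F.deg_zero] at this
  simpa using this

theorem mem_regSet_iff {I : Ideal (MvPolynomial σ K)} (D : ℕ) :
    (D : ℤ) ∈ regSet I ↔ ∀ k, P k (fun _ => 0) (Jsub I) (D + 1) := by
  constructor
  · rintro ⟨F, hF⟩
    exact P_Jsub_of_res F D fun i k => by exact_mod_cast hF i k
  · intro h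
    obtain ⟨F, hF⟩ := res_of_P D h
    exact ⟨F, fun i k => by exact_mod_cast hF i k⟩

theorem FG_of_mem {I : Ideal (MvPolynomial σ K)} {d : ℤ} (h : d ∈ regSet I) : I.FG := by
  obtain ⟨D, rfl⟩ := Int.eq_ofNat_of_zero_le (regSet_nonneg h)
  obtain ⟨F, hF⟩ := h
  exact FG_of_res F D fun i k => by exact_mod_cast hF i k

theorem regSet_bdd (I : Ideal (MvPolynomial σ K)) : BddBelow (regSet I) :=
  ⟨0, fun _ h => regSet_nonneg h⟩

theorem regQuot_eq {I : Ideal (MvPolynomial σ K)} (h : I ≠ ⊤) :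
    regQuot I = ((sInf (regSet I) : ℤ) : WithBot ℤ) := by
  rw [regQuot, if_neg h]; rfl

theorem sInf_regSet_nonneg (I : Ideal (MvPolynomial σ K)) : 0 ≤ sInf (regSet I) := by
  rcases (regSet I).eq_empty_or_nonempty with h | h
  · rw [h, Int.csInf_empty]
  · exact regSet_nonneg (Int.csInf_mem h (regSet_bdd I))

theorem main {I : Ideal (MvPolynomial σ K)} (hI : HomI I) {f : MvPolynomial σ K} {d : ℕ}
    (hd : 0 < d) (hf : f.IsHomogeneous d) :
    regQuot I ≤
      max (regQuot (Submodule.colon I (Ideal.span {f} : Set (MvPolynomial σ K)))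
        + ((d : ℤ) : WithBot ℤ)) (regQuot (I ⊔ Ideal.span {f})) := by
  by_cases hT : I = ⊤
  · rw [regQuot, if_pos hT]; exact bot_le
  by_cases hfI : f ∈ I
  · have : I ⊔ Ideal.span {f} = I := by
      rw [sup_eq_left, Ideal.span_le]; simpa using hfI
    rw [this]
    exact le_max_right _ _
  have hcol : Submodule.colon I (Ideal.span {f} : Set (MvPolynomial σ K)) ≠ ⊤ := by
    rw [Ideal.ne_top_iff_one, mem_colon_span, mul_one]; exact hfI
  have hsup : I ⊔ Ideal.span {f} ≠ ⊤ := by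
    rw [Ideal.ne_top_iff_one, mem_sup_span]
    rintro ⟨i, hi, q, hq⟩
    apply hT
    rw [Ideal.eq_top_iff_one]
    have h0 := congrArg (hcz (0 : ℤ)) hq
    rw [hcz_one_self, map_add, hcz_mul_of_left ((hcz_eq_self_iff d f).2 hf)] at h0
    have hz : hcz (0 - (d : ℤ)) q = 0 := by rw [hcz, if_neg (by omega)]; rfl
    rw [hz, mul_zero, add_zero] at h0
    rw [h0]; exact hI i hi 0
  rw [regQuot_eq hT, regQuot_eq hcol, regQuot_eq hsup, ← WithBot.coe_add, ← WithBot.coe_max,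
    WithBot.coe_le_coe]
  rcases (regSet I).eq_empty_or_nonempty with h | ⟨x, hx⟩
  · rw [h, Int.csInf_empty]
    exact le_max_of_le_right (sInf_regSet_nonneg _)
  obtain ⟨⟨r1, hr1⟩, ⟨r2, hr2⟩⟩ := exists_P_colon_sup hI (FG_of_mem hx) hf
  have m1 := Int.csInf_mem ⟨_, (mem_regSet_iff r1).2 fun k => (hr1 k).mono (Nat.le_succ _)⟩
    (regSet_bdd _)
  have m2 := Int.csInf_mem ⟨_, (mem_regSet_iff r2).2 fun k => (hr2 k).mono (Nat.le_succ _)⟩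
    (regSet_bdd _)
  obtain ⟨d1, hd1⟩ := Int.eq_ofNat_of_zero_le (regSet_nonneg m1)
  obtain ⟨d2, hd2⟩ := Int.eq_ofNat_of_zero_le (regSet_nonneg m2)
  rw [hd1] at m1 ⊢
  rw [hd2] at m2 ⊢
  rw [mem_regSet_iff] at m1 m2
  have key : ((max (d1 + d) d2 : ℕ) : ℤ) ∈ regSet I := by
    rw [mem_regSet_iff]
    intro k
    exact P_main hI hf (by have := le_max_left (d1 + d) d2; omega) (m1 k)
      ((m2 k).mono (Nat.succ_le_succ (le_max_right _ _)))
  have := csInf_le (regSet_bdd I) key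
  push_cast at this
  exact this

end RegAux

open EdgeIdealReg in
/-- For a nonzero homogeneous ideal `I` and a homogeneous `f` of degree `d > 0`,
`reg(S/I) ≤ max { reg(S/(I:f)) + d, reg(S/(I,f)) }`, with `reg(S/S) = -∞`. -/
theorem reg_le_max_colon_add {σ K : Type} [Field K] (I : Ideal (MvPolynomial σ K))
    (hI : I ≠ ⊥)
    (hhom : ∃ Gens : Set (MvPolynomial σ K),
      (∀ p ∈ Gens, ∃ n, p.IsHomogeneous n) ∧ I = Ideal.span Gens)
    (f : MvPolynomial σ K) (d : ℕ) (hd : 0 < d) (hf : f.IsHomogeneous d) :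
    regQuot I ≤
      max (regQuot (Submodule.colon I (Ideal.span {f})) + ((d : ℤ) : WithBot ℤ))
        (regQuot (I ⊔ Ideal.span {f})) := by
  obtain ⟨s, hs, rfl⟩ := hhom
  exact RegAux.main (RegAux.HomI_span s hs) hd hf
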